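/- Let μ be a Radon measure on ℝⁿ (a Borel measure finite on compact sets), let 1 ≤ p < ∞, let γ > d > 0, and assume there are constants c₁, c₂ > 0 with c₁ ℓ(Q)^d ≤ μ(Q) ≤ c₂ ℓ(Q)^d for all Q ∈ 𝒟. Then for any sequence a = {a_Q}_{Q∈𝒟} of real numbers there is a constant C = C(n,γ,d,c₁,c₂) such that sup_{λ>0} λᵖ ∑_{Q∈𝒟 : |a_Q|>λ} ℓ(Q)^{−γ} μ(Q) ≤ C · sup_{λ>0} λᵖ sup_{𝒫} ∑_{Q∈𝒫 : |a_Q|>λ} ℓ(Q)^{−γ} μ(Q), where the inner supremum is over all collections 𝒫 ⊂ 𝒟 of pairwise disjoint dyadic cubes. -/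

import Mathlib

open MeasureTheory Set
open scoped ENNReal Classical

noncomputable section

/-- The half-open dyadic cube in `ℝⁿ` of generation `k` (sidelength `2 ^ k`) and
corner index `j`, i.e. `∏ᵢ [jᵢ 2ᵏ, (jᵢ+1) 2ᵏ)`. -/
def dyadicCube (n : ℕ) (k : ℤ) (j : Fin n → ℤ) : Set (Fin n → ℝ) :=
  Set.univ.pi fun i => Set.Ico ((j i : ℝ) * 2 ^ k) (((j i : ℝ) + 1) * 2 ^ k)

/-- The index of the dyadic cube `m` generations above the cube with index `Q`. -/
def dyadicAncestor {n : ℕ} (m : ℕ) (Q : ℤ × (Fin n → ℤ)) : ℤ × (Fin n → ℤ) :=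
  (Q.1 + m, fun i => Q.2 i / 2 ^ m)

lemma dyadicAncestor_zero {n : ℕ} (Q : ℤ × (Fin n → ℤ)) : dyadicAncestor 0 Q = Q := by
  simp [dyadicAncestor]

lemma dyadicAncestor_dyadicAncestor {n : ℕ} (m m' : ℕ) (Q : ℤ × (Fin n → ℤ)) :
    dyadicAncestor m (dyadicAncestor m' Q) = dyadicAncestor (m' + m) Q := by
  refine Prod.ext ?_ (funext fun i => ?_)
  · simp [dyadicAncestor, add_assoc]
  · simp only [dyadicAncestor]
    rw [Int.ediv_ediv_of_nonneg (by positivity), pow_add]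

lemma floor_div_eq_of_mem_dyadicCube {n : ℕ} {k : ℤ} {j : Fin n → ℤ} {x : Fin n → ℝ}
    (hx : x ∈ dyadicCube n k j) (i : Fin n) : ⌊x i / 2 ^ k⌋ = j i := by
  have h := hx i (Set.mem_univ i)
  have h2 : (0 : ℝ) < 2 ^ k := by positivity
  rw [Int.floor_eq_iff, le_div_iff₀ h2, div_lt_iff₀ h2]
  exact h

lemma eq_dyadicAncestor_of_mem {n : ℕ} {Q Q' : ℤ × (Fin n → ℤ)} {x : Fin n → ℝ}
    (hx : x ∈ dyadicCube n Q.1 Q.2) (hx' : x ∈ dyadicCube n Q'.1 Q'.2) (h : Q'.1 ≤ Q.1) :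
    dyadicAncestor (Q.1 - Q'.1).toNat Q' = Q := by
  obtain ⟨m, hm⟩ := Int.le.dest h
  have hm' : (Q.1 - Q'.1).toNat = m := by omega
  rw [hm']
  refine Prod.ext hm (funext fun i => ?_)
  simp only [dyadicAncestor]
  rw [← floor_div_eq_of_mem_dyadicCube hx i, ← floor_div_eq_of_mem_dyadicCube hx' i, ← hm,
    zpow_add₀ two_ne_zero, ← div_div, zpow_natCast]
  have := Int.floor_div_natCast (x i / 2 ^ Q'.1) (2 ^ m)
  push_cast at this
  exact this.symm

/-- The elements of `S` that are not a proper ancestor of another element of `S`. -/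
def minimalCubes {n : ℕ} (S : Set (ℤ × (Fin n → ℤ))) : Set (ℤ × (Fin n → ℤ)) :=
  {Q | Q ∈ S ∧ ∀ m : ℕ, ∀ Q' ∈ S, dyadicAncestor m Q' = Q → m = 0}

lemma pairwiseDisjoint_minimalCubes {n : ℕ} (S : Set (ℤ × (Fin n → ℤ))) :
    (minimalCubes S).PairwiseDisjoint fun Q => dyadicCube n Q.1 Q.2 := by
  have key : ∀ Q ∈ minimalCubes S, ∀ Q' ∈ minimalCubes S, ∀ x ∈ dyadicCube n Q.1 Q.2,
      x ∈ dyadicCube n Q'.1 Q'.2 → Q'.1 ≤ Q.1 → Q' = Q := by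
    intro Q hQ Q' hQ' x hx hx' h
    have h1 := eq_dyadicAncestor_of_mem hx hx' h
    have h2 := hQ.2 _ Q' hQ'.1 h1
    rwa [h2, dyadicAncestor_zero] at h1
  intro Q hQ Q' hQ' hne
  refine Set.disjoint_left.2 fun x hx hx' => hne ?_
  rcases le_total Q'.1 Q.1 with h | h
  · exact (key Q hQ Q' hQ' x hx hx' h).symm
  · exact key Q' hQ' Q hQ x hx' hx h

lemma exists_minimalCubes_dyadicAncestor_eq {n : ℕ} {S : Set (ℤ × (Fin n → ℤ))} {K : ℤ}
    (hK : ∀ Q ∈ S, K ≤ Q.1) {Q : ℤ × (Fin n → ℤ)} (hQ : Q ∈ S) :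
    ∃ Q' ∈ minimalCubes S, ∃ m : ℕ, dyadicAncestor m Q' = Q := by
  induction h : (Q.1 - K).toNat using Nat.strong_induction_on generalizing Q with
  | _ N ih =>
    by_cases hmin : Q ∈ minimalCubes S
    · exact ⟨Q, hmin, 0, dyadicAncestor_zero Q⟩
    · have : ∃ m : ℕ, ∃ Q' ∈ S, dyadicAncestor m Q' = Q ∧ m ≠ 0 := by
        by_contra! hc
        exact hmin ⟨hQ, hc⟩
      obtain ⟨m, Q', hQ', rfl, hm⟩ := this
      have hK' := hK Q' hQ'
      have hlt : (Q'.1 - K).toNat < N := by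
        simp only [dyadicAncestor] at h
        omega
      obtain ⟨R, hR, m', rfl⟩ := ih _ hlt hQ' rfl
      exact ⟨R, hR, m' + m, (dyadicAncestor_dyadicAncestor m m' R).symm⟩

lemma tsum_ite_le_tsum_minimalCubes {n : ℕ} {S : Set (ℤ × (Fin n → ℤ))} {K : ℤ}
    (hK : ∀ Q ∈ S, K ≤ Q.1) (w : ℤ × (Fin n → ℤ) → ℝ≥0∞) :
    ∑' Q, (if Q ∈ S then w Q else 0) ≤
      ∑' Q, if Q ∈ minimalCubes S then ∑' m : ℕ, w (dyadicAncestor m Q) else 0 := by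
  calc ∑' Q, (if Q ∈ S then w Q else 0)
      ≤ ∑' Q, ∑' Q', ∑' m : ℕ,
          if Q = dyadicAncestor m Q' then (if Q' ∈ minimalCubes S then w Q else 0) else 0 := by
        refine ENNReal.tsum_le_tsum fun Q => ?_
        split_ifs with hQ
        · obtain ⟨Q', hQ', m, hm⟩ := exists_minimalCubes_dyadicAncestor_eq hK hQ
          refine le_trans ?_ (ENNReal.le_tsum Q')
          refine le_trans ?_ (ENNReal.le_tsum m)
          rw [if_pos hm.symm, if_pos hQ']
        · exact zero_le
    _ = ∑' Q, if Q ∈ minimalCubes S then ∑' m : ℕ, w (dyadicAncestor m Q) else 0 := by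
        rw [ENNReal.tsum_comm]
        refine tsum_congr fun Q' => ?_
        rw [ENNReal.tsum_comm]
        simp_rw [tsum_ite_eq]
        split_ifs <;> simp

lemma tsum_ofReal_mul_zpow_add {c r : ℝ} (hc : 0 ≤ c) (hr : 0 < r) (hr1 : r < 1) (k : ℤ) :
    ∑' m : ℕ, ENNReal.ofReal (c * r ^ (k + m)) = ENNReal.ofReal (c * r ^ k / (1 - r)) := by
  have h : ∀ m : ℕ, c * r ^ (k + m) = c * r ^ k * r ^ m := fun m => by
    rw [zpow_add₀ hr.ne', zpow_natCast, mul_assoc]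
  simp_rw [h]
  rw [← ENNReal.ofReal_tsum_of_nonneg (fun m => by positivity)
    ((summable_geometric_of_lt_one hr.le hr1).mul_left _), tsum_mul_left,
    tsum_geometric_of_lt_one hr.le hr1, div_eq_mul_inv]

lemma exists_le_of_zpow_le {r : ℝ} (hr : 0 < r) (hr1 : r < 1) (B : ℝ) :
    ∃ K : ℤ, ∀ k : ℤ, r ^ k ≤ B → K ≤ k := by
  obtain ⟨N, hN⟩ := pow_unbounded_of_one_lt B ((one_lt_inv₀ hr).2 hr1)
  refine ⟨-N, fun k hk => ?_⟩
  by_contra! hlt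
  have h1 : r ^ (-(N : ℤ)) ≤ r ^ k := zpow_le_zpow_right_of_le_one₀ hr hr1.le hlt.le
  rw [zpow_neg, zpow_natCast, ← inv_pow] at h1
  linarith

/-- If the weight of a dyadic cube of generation `k` is comparable to `r ^ k` with `0 < r < 1`, the
total weight of a family is controlled by that of its pairwise disjoint subfamilies. -/
lemma tsum_le_iSup_pairwiseDisjoint {n : ℕ} {c₁ c₂ r : ℝ} (hc₁ : 0 < c₁) (hc₂ : 0 < c₂)
    (hr : 0 < r) (hr1 : r < 1) (w : ℤ × (Fin n → ℤ) → ℝ≥0∞)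
    (hw₁ : ∀ Q, ENNReal.ofReal (c₁ * r ^ Q.1) ≤ w Q)
    (hw₂ : ∀ Q, w Q ≤ ENNReal.ofReal (c₂ * r ^ Q.1)) (S : Set (ℤ × (Fin n → ℤ))) :
    ∑' Q, (if Q ∈ S then w Q else 0) ≤ ENNReal.ofReal (c₂ / (c₁ * (1 - r))) *
      ⨆ (P : Set (ℤ × (Fin n → ℤ))) (_ : P.PairwiseDisjoint fun Q => dyadicCube n Q.1 Q.2),
        ∑' Q, if Q ∈ P ∧ Q ∈ S then w Q else 0 := by
  have hr' : 0 < 1 - r := sub_pos.2 hr1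
  have hC : 0 < c₂ / (c₁ * (1 - r)) := by positivity
  set M := ⨆ (P : Set (ℤ × (Fin n → ℤ)))
    (_ : P.PairwiseDisjoint fun Q => dyadicCube n Q.1 Q.2),
      ∑' Q, if Q ∈ P ∧ Q ∈ S then w Q else 0 with hM
  have hle : ∀ P : Set (ℤ × (Fin n → ℤ)),
      (P.PairwiseDisjoint fun Q => dyadicCube n Q.1 Q.2) →
      ∑' Q, (if Q ∈ P ∧ Q ∈ S then w Q else 0) ≤ M := fun P hP =>
    le_iSup₂ (f := fun (P : Set (ℤ × (Fin n → ℤ)))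
      (_ : P.PairwiseDisjoint fun Q => dyadicCube n Q.1 Q.2) =>
        ∑' Q, if Q ∈ P ∧ Q ∈ S then w Q else 0) P hP
  by_cases htop : M = ∞
  · rw [htop, ENNReal.mul_top (ENNReal.ofReal_pos.2 hC).ne']
    exact le_top
  obtain ⟨K, hK⟩ := exists_le_of_zpow_le hr hr1 (M.toReal / c₁)
  have hKS : ∀ Q ∈ S, K ≤ Q.1 := by
    intro Q hQ
    refine hK _ ?_
    have h1 : w Q ≤ M := by
      refine le_trans ?_ (hle {Q} (Set.pairwiseDisjoint_singleton _ _))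
      refine le_trans ?_ (ENNReal.le_tsum Q)
      rw [if_pos ⟨Set.mem_singleton Q, hQ⟩]
    have h2 := (ENNReal.ofReal_le_iff_le_toReal htop).1 ((hw₁ Q).trans h1)
    rw [le_div_iff₀ hc₁]
    linarith
  calc ∑' Q, (if Q ∈ S then w Q else 0)
      ≤ ∑' Q, if Q ∈ minimalCubes S then ∑' m : ℕ, w (dyadicAncestor m Q) else 0 :=
        tsum_ite_le_tsum_minimalCubes hKS w
    _ ≤ ∑' Q, ENNReal.ofReal (c₂ / (c₁ * (1 - r))) *
          if Q ∈ minimalCubes S ∧ Q ∈ S then w Q else 0 := by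
        refine ENNReal.tsum_le_tsum fun Q => ?_
        by_cases hQ : Q ∈ minimalCubes S
        · rw [if_pos hQ, if_pos ⟨hQ, hQ.1⟩]
          calc ∑' m : ℕ, w (dyadicAncestor m Q)
              ≤ ∑' m : ℕ, ENNReal.ofReal (c₂ * r ^ (Q.1 + m)) :=
                ENNReal.tsum_le_tsum fun m => hw₂ (dyadicAncestor m Q)
            _ = ENNReal.ofReal (c₂ / (c₁ * (1 - r))) * ENNReal.ofReal (c₁ * r ^ Q.1) := by
                rw [tsum_ofReal_mul_zpow_add hc₂.le hr hr1, ← ENNReal.ofReal_mul hC.le]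
                congr 1
                field_simp
            _ ≤ _ := by gcongr; exact hw₁ Q
        · rw [if_neg hQ]
          exact zero_le
    _ ≤ ENNReal.ofReal (c₂ / (c₁ * (1 - r))) * M := by
        rw [ENNReal.tsum_mul_left]
        gcongr
        exact hle _ (pairwiseDisjoint_minimalCubes S)

lemma zpow_rpow_neg_mul_zpow_rpow (γ d : ℝ) (k : ℤ) :
    ((2 : ℝ) ^ k) ^ (-γ) * ((2 : ℝ) ^ k) ^ d = ((2 : ℝ) ^ (d - γ)) ^ k := by
  rw [← Real.rpow_add (by positivity), ← Real.rpow_intCast, ← Real.rpow_intCast,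
    ← Real.rpow_mul zero_le_two, ← Real.rpow_mul zero_le_two]
  congr 1
  ring

/-- for `γ > d > 0` and a Radon measure `μ` with `μ(Q) ≈ ℓ(Q)^d` on dyadic
cubes, the full weak-type sum over all dyadic cubes is controlled by the corresponding
supremum over pairwise disjoint collections of dyadic cubes. -/
theorem statement5 (n : ℕ) (γ d c₁ c₂ : ℝ) (hd : 0 < d) (hγ : d < γ)
    (hc₁ : 0 < c₁) (hc₂ : 0 < c₂) :
    ∃ C : ℝ, 0 < C ∧
      ∀ (μ : Measure (Fin n → ℝ)), IsFiniteMeasureOnCompacts μ →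
      (∀ (k : ℤ) (j : Fin n → ℤ),
        ENNReal.ofReal (c₁ * ((2 : ℝ) ^ k) ^ d) ≤ μ (dyadicCube n k j) ∧
        μ (dyadicCube n k j) ≤ ENNReal.ofReal (c₂ * ((2 : ℝ) ^ k) ^ d)) →
      ∀ (p : ℝ), 1 ≤ p →
      ∀ (a : ℤ × (Fin n → ℤ) → ℝ),
      (⨆ l ∈ Set.Ioi (0 : ℝ), ENNReal.ofReal (l ^ p) *
          ∑' Q : ℤ × (Fin n → ℤ),
            if l < |a Q| then
              ENNReal.ofReal (((2 : ℝ) ^ Q.1) ^ (-γ)) * μ (dyadicCube n Q.1 Q.2) else 0)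
        ≤ ENNReal.ofReal C *
          ⨆ l ∈ Set.Ioi (0 : ℝ), ENNReal.ofReal (l ^ p) *
            ⨆ (P : Set (ℤ × (Fin n → ℤ)))
              (_ : P.PairwiseDisjoint fun Q => dyadicCube n Q.1 Q.2),
              ∑' Q : ℤ × (Fin n → ℤ),
                if Q ∈ P ∧ l < |a Q| then
                  ENNReal.ofReal (((2 : ℝ) ^ Q.1) ^ (-γ)) * μ (dyadicCube n Q.1 Q.2) else 0 := by
  have hr : (0 : ℝ) < 2 ^ (d - γ) := by positivity
  have hr1 : (2 : ℝ) ^ (d - γ) < 1 :=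
    Real.rpow_lt_one_of_one_lt_of_neg one_lt_two (sub_neg.2 hγ)
  have hr' : (0 : ℝ) < 1 - 2 ^ (d - γ) := sub_pos.2 hr1
  refine ⟨c₂ / (c₁ * (1 - 2 ^ (d - γ))), by positivity, fun μ _ hμ p _ a => ?_⟩
  have hofReal : ∀ (c : ℝ) (k : ℤ), ENNReal.ofReal (((2 : ℝ) ^ k) ^ (-γ)) *
      ENNReal.ofReal (c * ((2 : ℝ) ^ k) ^ d) =
        ENNReal.ofReal (c * ((2 : ℝ) ^ (d - γ)) ^ k) := fun c k => by
    rw [← ENNReal.ofReal_mul (by positivity), ← zpow_rpow_neg_mul_zpow_rpow]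
    congr 1
    ring
  refine iSup₂_le fun l hl => ?_
  have key := tsum_le_iSup_pairwiseDisjoint hc₁ hc₂ hr hr1
    (fun Q : ℤ × (Fin n → ℤ) =>
      ENNReal.ofReal (((2 : ℝ) ^ Q.1) ^ (-γ)) * μ (dyadicCube n Q.1 Q.2))
    (fun Q => by rw [← hofReal]; gcongr; exact (hμ Q.1 Q.2).1)
    (fun Q => by rw [← hofReal]; gcongr; exact (hμ Q.1 Q.2).2) {Q | l < |a Q|}
  simp only [Set.mem_ofPred_eq] at key
  refine (mul_le_mul_right key _).trans ?_
  rw [mul_left_comm]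
  refine mul_le_mul_right ?_ _
  exact le_iSup₂ (f := fun (l : ℝ) (_ : l ∈ Set.Ioi (0 : ℝ)) => ENNReal.ofReal (l ^ p) *
    ⨆ (P : Set (ℤ × (Fin n → ℤ))) (_ : P.PairwiseDisjoint fun Q => dyadicCube n Q.1 Q.2),
      ∑' Q : ℤ × (Fin n → ℤ), if Q ∈ P ∧ l < |a Q| then
        ENNReal.ofReal (((2 : ℝ) ^ Q.1) ^ (-γ)) * μ (dyadicCube n Q.1 Q.2) else 0) l hl
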